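/- arXiv:2203.10732 — 2 statements merged into one kernel-verified Lean document; each statement's English description precedes it below -/
import Mathlib

section
/- Stirling-type minimization lemma used to convert spectral approximation bounds into exponential decay: for every real C > 0, every real d > 0 and every integer k ≥ 0, there exist constants c' > 0 and b > 0 such that for every integer W ≥ 2 there exists an integer s with 1 ≤ s ≤ W satisfying e^{2s} · W^{k-2s} · (C d^s s!)² ≤ c' e^{-bW}. -/
/-- If `e² d s ≤ W`, the factor `e^s d^s s! / W^s` is at most `e^{-s}`. -/
theorem exp_mul_pow_mul_factorial_div_pow_le {d W : ℝ} (hd : 0 ≤ d) (hW : 0 < W) (s : ℕ)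
    (h : Real.exp 2 * d * s ≤ W) :
    Real.exp s * d ^ s * (Nat.factorial s : ℝ) / W ^ s ≤ Real.exp (-s) := by
  have hfac : (Nat.factorial s : ℝ) ≤ (s : ℝ) ^ s := by exact_mod_cast Nat.factorial_le_pow s
  have hbase : Real.exp 1 * d * s ≤ Real.exp (-1) * W := by
    calc Real.exp 1 * d * s = Real.exp (-1) * (Real.exp 2 * d * s) := by
          rw [show (1 : ℝ) = -1 + 2 by norm_num, Real.exp_add]
          norm_num
          ring
      _ ≤ Real.exp (-1) * W := by gcongr
  have hexp (x : ℝ) : Real.exp (s * x) = Real.exp x ^ s := Real.exp_nat_mul x s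
  rw [div_le_iff₀ (by positivity)]
  calc Real.exp s * d ^ s * (Nat.factorial s : ℝ) ≤ Real.exp s * d ^ s * (s : ℝ) ^ s := by gcongr
    _ = (Real.exp 1 * d * s) ^ s := by
        rw [mul_pow, mul_pow, ← hexp, mul_one]
    _ ≤ (Real.exp (-1) * W) ^ s := by gcongr
    _ = Real.exp (-s) * W ^ s := by rw [mul_pow, ← hexp, mul_neg_one]


/-- **Stirling-type minimization lemma** used to convert spectral approximation bounds
into exponential decay: for every `C > 0`, `d > 0` and integer `k ≥ 0` there are
constants `c' > 0` and `b > 0` such that for every integer `W ≥ 2` there is an integer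
`s` with `1 ≤ s ≤ W` and `e^{2s} · W^{k-2s} · (C d^s s!)² ≤ c' e^{-bW}`,
where `W^{k-2s} = W^k / W^{2s}`. -/
theorem stirling_minimization (C d : ℝ) (hC : 0 < C) (hd : 0 < d) (k : ℕ) :
    ∃ c' > (0 : ℝ), ∃ b > (0 : ℝ), ∀ W : ℕ, 2 ≤ W → ∃ s : ℕ, 1 ≤ s ∧ s ≤ W ∧
      Real.exp (2 * (s : ℝ)) * ((W : ℝ) ^ k / (W : ℝ) ^ (2 * s)) *
          (C * d ^ s * (Nat.factorial s : ℝ)) ^ 2 ≤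
        c' * Real.exp (-(b * (W : ℝ))) := by
  obtain ⟨N, hN⟩ := exists_nat_ge (Real.exp 2 * d)
  have hN0 : 0 < N := by
    have : (0 : ℝ) < N := lt_of_lt_of_le (by positivity) hN
    exact_mod_cast this
  have hNR : (0 : ℝ) < N := by exact_mod_cast hN0
  refine ⟨C ^ 2 * Real.exp 2 * (Nat.factorial k * (N : ℝ) ^ k) +
    Real.exp 3 * (N : ℝ) ^ k * C ^ 2 * d ^ 2, by positivity, 1 / N, by positivity, ?_⟩
  intro W hW
  have hWR : (2 : ℝ) ≤ W := by exact_mod_cast hW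
  have hW0 : (0 : ℝ) < W := by linarith
  rcases lt_or_ge W N with hlt | hge
  · refine ⟨1, le_rfl, by omega, ?_⟩
    have hWN : (W : ℝ) ≤ N := by exact_mod_cast hlt.le
    have hdecay : Real.exp (-1) ≤ Real.exp (-(1 / N * (W : ℝ))) := by
      have : (1 / N * (W : ℝ)) ≤ 1 := by
        rw [one_div_mul_eq_div]
        exact (div_le_one hNR).2 hWN
      gcongr
    have hdiv : (W : ℝ) ^ k / (W : ℝ) ^ (2 * 1) ≤ (N : ℝ) ^ k :=
      (div_le_self (by positivity) (one_le_pow₀ (by linarith))).trans (by gcongr)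
    calc _ ≤ Real.exp (2 * ((1 : ℕ) : ℝ)) * (N : ℝ) ^ k *
          (C * d ^ 1 * (Nat.factorial 1 : ℝ)) ^ 2 := by gcongr
      _ = (Real.exp 3 * (N : ℝ) ^ k * C ^ 2 * d ^ 2) * Real.exp (-1) := by
          rw [show (2 * ((1 : ℕ) : ℝ)) = 3 + -1 by norm_num, Real.exp_add]
          simp only [pow_one, Nat.factorial_one, Nat.cast_one]
          ring
      _ ≤ _ := by
          gcongr
          exact le_add_of_nonneg_left (by positivity)
  · refine ⟨W / N, Nat.div_pos hge hN0, Nat.div_le_self _ _, ?_⟩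
    have hle : (N : ℝ) * (W / N : ℕ) ≤ W := by exact_mod_cast Nat.mul_div_le W N
    have hgt : (W : ℝ) / N - 1 ≤ (W / N : ℕ) := by
      have : (W : ℝ) < N * ((W / N : ℕ) + 1) := by exact_mod_cast Nat.lt_mul_div_succ W hN0
      rw [sub_le_iff_le_add, div_le_iff₀' hNR]
      exact this.le
    generalize W / N = s at hle hgt ⊢
    have hA := exp_mul_pow_mul_factorial_div_pow_le hd.le hW0 s
      ((mul_le_mul_of_nonneg_right hN s.cast_nonneg).trans hle)
    have hpoly : (W : ℝ) ^ k ≤ Nat.factorial k * (N : ℝ) ^ k * Real.exp (W / N) := by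
      have h := Real.pow_div_factorial_le_exp ((W : ℝ) / N) (by positivity) k
      rw [div_pow, div_div, div_le_iff₀ (by positivity)] at h
      linarith
    calc _ = C ^ 2 * (W : ℝ) ^ k *
          (Real.exp s * d ^ s * (Nat.factorial s : ℝ) / (W : ℝ) ^ s) ^ 2 := by
          rw [two_mul, Real.exp_add, two_mul, pow_add]
          field_simp
      _ ≤ C ^ 2 * (Nat.factorial k * (N : ℝ) ^ k * Real.exp (W / N)) * Real.exp (-s) ^ 2 := by
          gcongr
      _ ≤ C ^ 2 * (Nat.factorial k * (N : ℝ) ^ k * Real.exp (W / N)) *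
          Real.exp (-((W : ℝ) / N - 1)) ^ 2 := by gcongr
      _ = C ^ 2 * Real.exp 2 * (Nat.factorial k * (N : ℝ) ^ k) *
          Real.exp (-(1 / N * (W : ℝ))) := by
          have : Real.exp ((W : ℝ) / N) * Real.exp (-((W : ℝ) / N - 1)) ^ 2 =
              Real.exp 2 * Real.exp (-(1 / N * (W : ℝ))) := by
            rw [← Real.exp_nat_mul, ← Real.exp_add, ← Real.exp_add]
            congr 1
            push_cast
            ring
          linear_combination C ^ 2 * (Nat.factorial k * (N : ℝ) ^ k) * this
      _ ≤ _ := by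
          gcongr
          exact le_add_of_nonneg_right (by positivity)
end

section
/- Exponential polynomial approximation of analytic functions in the H²-norm on the reference square (derived in the proof of Theorem 5.1): let v : Q̄ → ℝ be infinitely differentiable and satisfy the analytic bounds ‖v‖_{s,Q} ≤ C d^s s! for all integers s ≥ 0 and some constants C, d > 0. Then there exist constants c' > 0 and b > 0, depending only on C and d, such that for every sufficiently large integer W there exists a polynomial Φ of degree ≤ W in each of the two variables with ‖v - Φ‖_{2,Q}² ≤ c' e^{-bW}; moreover the same statement holds with the norm ‖v - Φ‖_{1,Q}² or ‖v - Φ‖_{0,Q}² in place of ‖v - Φ‖_{2,Q}². -/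
/-!
Common setup for the least-squares spectral element formulation of the Stokes
equations on a mesh of axis-parallel rectangles, following the paper
"Least-squares formulations for Stokes equations with non-standard boundary
conditions - A unified approach".
-/

open MeasureTheory Set
open scoped Classical

noncomputable section

/-- Partial derivative in the first (physical or reference) variable. -/
def pdx (v : ℝ × ℝ → ℝ) : ℝ × ℝ → ℝ := fun z => deriv (fun t => v (t, z.2)) z.1

/-- Partial derivative in the second variable. -/
def pdy (v : ℝ × ℝ → ℝ) : ℝ × ℝ → ℝ := fun z => deriv (fun t => v (z.1, t)) z.2

/-- Mixed partial derivative `D^(a,b)`. -/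
def Dab (a b : ℕ) (v : ℝ × ℝ → ℝ) : ℝ × ℝ → ℝ := pdx^[a] (pdy^[b] v)

/-- The reference square `Q = (-1,1)²`. -/
def Q2 : Set (ℝ × ℝ) := Ioo (-1 : ℝ) 1 ×ˢ Ioo (-1 : ℝ) 1

/-- The reference edge `E = (-1,1)`. -/
def E1 : Set ℝ := Ioo (-1 : ℝ) 1

/-- Squared Sobolev norm of integer order `m` on a set `S ⊆ ℝ²`:
`‖v‖_{m,S}² = Σ_{|α| ≤ m} ∫_S |D^α v|²`. -/
def sobOn (S : Set (ℝ × ℝ)) (m : ℕ) (v : ℝ × ℝ → ℝ) : ℝ :=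
  ∑ a ∈ Finset.range (m + 1), ∑ b ∈ Finset.range (m + 1 - a), ∫ z in S, (Dab a b v z) ^ 2

/-- Squared Sobolev norm of a vector field (sum over components). -/
def sobOnv (S : Set (ℝ × ℝ)) (m : ℕ) (v : ℝ × ℝ → ℝ × ℝ) : ℝ :=
  sobOn S m (fun z => (v z).1) + sobOn S m (fun z => (v z).2)

/-- Squared Sobolev `m`-norm on the reference square `Q`. -/
def sobQ (m : ℕ) (v : ℝ × ℝ → ℝ) : ℝ := sobOn Q2 m v

/-- Squared Sobolev `m`-norm on `Q`, vector version. -/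
def sobQv (m : ℕ) (v : ℝ × ℝ → ℝ × ℝ) : ℝ := sobOnv Q2 m v

/-- Squared Sobolev norm of integer order `m` on `E = (-1,1)`. -/
def sobE (m : ℕ) (w : ℝ → ℝ) : ℝ :=
  ∑ j ∈ Finset.range (m + 1), ∫ x in E1, (deriv^[j] w x) ^ 2

/-- Squared `H^{1/2}` norm on `E` (Gagliardo double integral). -/
def halfE (w : ℝ → ℝ) : ℝ :=
  sobE 0 w + ∫ x in E1, ∫ y in E1, (w x - w y) ^ 2 / |x - y| ^ 2

/-- Squared `H^{3/2}` norm on `E`: `‖w‖_{3/2}² = ‖w‖_{1}² + ‖w'‖_{1/2}²`. -/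
def threeHalfE (w : ℝ → ℝ) : ℝ := sobE 1 w + halfE (deriv w)

/-- Vector versions of the edge norms (summed over components). -/
def sobEv (m : ℕ) (w : ℝ → ℝ × ℝ) : ℝ := sobE m (fun t => (w t).1) + sobE m (fun t => (w t).2)

def halfEv (w : ℝ → ℝ × ℝ) : ℝ := halfE (fun t => (w t).1) + halfE (fun t => (w t).2)

def threeHalfEv (w : ℝ → ℝ × ℝ) : ℝ :=
  threeHalfE (fun t => (w t).1) + threeHalfE (fun t => (w t).2)

/-- `v` is a polynomial of degree `≤ W` in each of the two variables. -/
def IsPoly2 (W : ℕ) (v : ℝ × ℝ → ℝ) : Prop :=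
  ∃ c : ℕ → ℕ → ℝ, ∀ z : ℝ × ℝ,
    v z = ∑ i ∈ Finset.range (W + 1), ∑ j ∈ Finset.range (W + 1), c i j * z.1 ^ i * z.2 ^ j

/-- Stokes momentum operator `L(u,p) = -Δu + ∇p` acting in the physical variables of an
element with half-widths `hx, hy`, expressed in reference coordinates. -/
def stokesLP (hx hy : ℝ) (u : ℝ × ℝ → ℝ × ℝ) (p : ℝ × ℝ → ℝ) : ℝ × ℝ → ℝ × ℝ := fun z =>
  (-((1 / hx) ^ 2 * Dab 2 0 (fun w => (u w).1) z + (1 / hy) ^ 2 * Dab 0 2 (fun w => (u w).1) z)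
      + (1 / hx) * pdx p z,
   -((1 / hx) ^ 2 * Dab 2 0 (fun w => (u w).2) z + (1 / hy) ^ 2 * Dab 0 2 (fun w => (u w).2) z)
      + (1 / hy) * pdy p z)

/-- Divergence operator `Du = -∇·u` in physical variables. -/
def stokesDP (hx hy : ℝ) (u : ℝ × ℝ → ℝ × ℝ) : ℝ × ℝ → ℝ := fun z =>
  -((1 / hx) * pdx (fun w => (u w).1) z + (1 / hy) * pdy (fun w => (u w).2) z)

/-- Scalar curl `∇×u = ∂u₂/∂x₁ - ∂u₁/∂x₂` in physical variables. -/
def curlP (hx hy : ℝ) (u : ℝ × ℝ → ℝ × ℝ) : ℝ × ℝ → ℝ := fun z =>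
  (1 / hx) * pdx (fun w => (u w).2) z - (1 / hy) * pdy (fun w => (u w).1) z

/-- First physical partial derivative of a vector field. -/
def pdxPv (hx : ℝ) (u : ℝ × ℝ → ℝ × ℝ) : ℝ × ℝ → ℝ × ℝ := fun z =>
  ((1 / hx) * pdx (fun w => (u w).1) z, (1 / hx) * pdx (fun w => (u w).2) z)

/-- Second physical partial derivative of a vector field. -/
def pdyPv (hy : ℝ) (u : ℝ × ℝ → ℝ × ℝ) : ℝ × ℝ → ℝ × ℝ := fun z =>
  ((1 / hy) * pdy (fun w => (u w).1) z, (1 / hy) * pdy (fun w => (u w).2) z)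

/-- Open axis-parallel rectangle with center `(cx,cy)` and half-widths `hx, hy`. -/
def rect (cx cy hx hy : ℝ) : Set (ℝ × ℝ) :=
  Ioo (cx - hx) (cx + hx) ×ˢ Ioo (cy - hy) (cy + hy)

/-- Affine parametrizations of the four edges of the reference square `Q`
(bottom, right, top, left). -/
def refPt : Fin 4 → ℝ → ℝ × ℝ :=
  ![fun t => (t, -1), fun t => (1, t), fun t => (t, 1), fun t => (-1, t)]

/-- Trace of a function on `Q` along the reference edge `e`, as a function on `E`. -/
def trE {α : Type*} (e : Fin 4) (v : ℝ × ℝ → α) : ℝ → α := fun t => v (refPt e t)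

/-- Outward unit normals of the four edges of an axis-parallel rectangle. -/
def nrm : Fin 4 → ℝ × ℝ := ![(0, -1), (1, 0), (0, 1), (-1, 0)]

/-- Euclidean inner product in ℝ². -/
def dot (a b : ℝ × ℝ) : ℝ := a.1 * b.1 + a.2 * b.2

/-- For a scalar `s` (e.g. the 2D curl) and unit vector `n = (n₁,n₂)`:
`s × n = s • (n₂, -n₁)`. -/
def cross2 (s : ℝ) (n : ℝ × ℝ) : ℝ × ℝ := (s * n.2, -(s * n.1))

/-- Scalar cross product `v × n = v₁ n₂ - v₂ n₁` in 2D. -/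
def crossV (v n : ℝ × ℝ) : ℝ := v.1 * n.2 - v.2 * n.1

/-- Inverse element map `M_l⁻¹ : Q → Ω_l`. -/
def mInv (cx cy hx hy : ℝ) (z : ℝ × ℝ) : ℝ × ℝ := (cx + hx * z.1, cy + hy * z.2)

/-- Element map `M_l : Ω_l → Q`. -/
def mFwd (cx cy hx hy : ℝ) (x : ℝ × ℝ) : ℝ × ℝ := ((x.1 - cx) / hx, (x.2 - cy) / hy)

/-- Closed edge `e` of the rectangle, as a subset of ℝ². -/
def edgeSet (cx cy hx hy : ℝ) (e : Fin 4) : Set (ℝ × ℝ) :=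
  (fun t => mInv cx cy hx hy (refPt e t)) '' Icc (-1 : ℝ) 1

/-- A mesh of `L` pairwise disjoint open axis-parallel rectangles decomposing a bounded
open set `dom ⊆ ℝ²`; any two rectangles meet in a common complete edge, a common vertex,
or not at all. -/
structure Mesh (L : ℕ) where
  dom : Set (ℝ × ℝ)
  cx : Fin L → ℝ
  cy : Fin L → ℝ
  hx : Fin L → ℝ
  hy : Fin L → ℝ
  hx_pos : ∀ l, 0 < hx l
  hy_pos : ∀ l, 0 < hy l
  dom_open : IsOpen dom
  dom_bdd : Bornology.IsBounded dom
  elt_sub : ∀ l, rect (cx l) (cy l) (hx l) (hy l) ⊆ dom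
  cover : closure dom = ⋃ l, closure (rect (cx l) (cy l) (hx l) (hy l))
  disj : ∀ l m, l ≠ m →
    Disjoint (rect (cx l) (cy l) (hx l) (hy l)) (rect (cx m) (cy m) (hx m) (hy m))
  conf : ∀ l m, l ≠ m →
    closure (rect (cx l) (cy l) (hx l) (hy l)) ∩
        closure (rect (cx m) (cy m) (hx m) (hy m)) = ∅ ∨
    (∃ v, closure (rect (cx l) (cy l) (hx l) (hy l)) ∩
        closure (rect (cx m) (cy m) (hx m) (hy m)) = {v}) ∨
    (∃ e f : Fin 4,
      edgeSet (cx l) (cy l) (hx l) (hy l) e = edgeSet (cx m) (cy m) (hx m) (hy m) f ∧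
      closure (rect (cx l) (cy l) (hx l) (hy l)) ∩
          closure (rect (cx m) (cy m) (hx m) (hy m)) =
        edgeSet (cx l) (cy l) (hx l) (hy l) e)

namespace Mesh

variable {L : ℕ} (M : Mesh L)

/-- The `l`-th open element `Ω_l`. -/
def elt (l : Fin L) : Set (ℝ × ℝ) := rect (M.cx l) (M.cy l) (M.hx l) (M.hy l)

/-- The closed edge `e` of element `l`. -/
def edge (l : Fin L) (e : Fin 4) : Set (ℝ × ℝ) :=
  edgeSet (M.cx l) (M.cy l) (M.hx l) (M.hy l) e

/-- The inverse element map `M_l⁻¹ : Q → Ω_l`. -/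
def mInvPt (l : Fin L) (z : ℝ × ℝ) : ℝ × ℝ := mInv (M.cx l) (M.cy l) (M.hx l) (M.hy l) z

/-- The element map `M_l : Ω_l → Q`. -/
def mFwdPt (l : Fin L) (x : ℝ × ℝ) : ℝ × ℝ := mFwd (M.cx l) (M.cy l) (M.hx l) (M.hy l) x

/-- Affine parametrization (induced by `M_l`) of edge `e` of element `l` over `E`. -/
def edgePt (l : Fin L) (e : Fin 4) (t : ℝ) : ℝ × ℝ := M.mInvPt l (refPt e t)

/-- Edge `e` of element `l` and edge `f` of element `m` are a shared interelement edge. -/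
def shared (l : Fin L) (e : Fin 4) (m : Fin L) (f : Fin 4) : Prop :=
  l ≠ m ∧ M.edge l e = M.edge m f

/-- Edge `e` of element `l` lies on the boundary `Γ = ∂Ω`. -/
def isBdry (l : Fin L) (e : Fin 4) : Prop := M.edge l e ⊆ frontier M.dom

end Mesh

variable {L : ℕ}

/-- Membership in the spectral element space `Π^{L,W}`. -/
def InPi (W : ℕ) (u : Fin L → ℝ × ℝ → ℝ × ℝ) (p : Fin L → ℝ × ℝ → ℝ) : Prop :=
  ∀ l, IsPoly2 W (fun z => (u l z).1) ∧ IsPoly2 W (fun z => (u l z).2) ∧ IsPoly2 W (p l)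

/-- The quadratic form `U^{L,W}(u,p) = Σ_l ‖u_l‖_{2,Q}² + Σ_l ‖p_l‖_{1,Q}²`. -/
def Ufn (u : Fin L → ℝ × ℝ → ℝ × ℝ) (p : Fin L → ℝ × ℝ → ℝ) : ℝ :=
  (∑ l : Fin L, sobQv 2 (u l)) + ∑ l : Fin L, sobQ 1 (p l)

/-- Interior residual part `Σ_l ‖L(u_l,p_l)‖_{0,Q}² + Σ_l ‖Du_l‖_{1,Q}²`. -/
def interiorRes (M : Mesh L) (u : Fin L → ℝ × ℝ → ℝ × ℝ) (p : Fin L → ℝ × ℝ → ℝ) : ℝ :=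
  (∑ l : Fin L, sobQv 0 (stokesLP (M.hx l) (M.hy l) (u l) (p l))) +
    ∑ l : Fin L, sobQ 1 (stokesDP (M.hx l) (M.hy l) (u l))

/-- Interelement jump terms
`Σ_{shared edges} ( ‖[u]‖₀² + Σ_k ‖[u_{x_k}]‖_{1/2}² + ‖[p]‖_{1/2}² )`. -/
def jumpTerms (M : Mesh L) (u : Fin L → ℝ × ℝ → ℝ × ℝ) (p : Fin L → ℝ × ℝ → ℝ) : ℝ :=
  ∑ l : Fin L, ∑ e : Fin 4, ∑ m : Fin L, ∑ f : Fin 4,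
    if M.shared l e m f then
      sobEv 0 (fun t => trE e (u l) t - trE f (u m) t) +
      halfEv (fun t => trE e (pdxPv (M.hx l) (u l)) t - trE f (pdxPv (M.hx m) (u m)) t) +
      halfEv (fun t => trE e (pdyPv (M.hy l) (u l)) t - trE f (pdyPv (M.hy m) (u m)) t) +
      halfE (fun t => trE e (p l) t - trE f (p m) t)
    else 0

/-- The function `sin (n arccos x)`, that is `U_{n-1}(x) √(1-x²)`. -/
def chebSin (n : ℕ) (x : ℝ) : ℝ := Real.sin (n * Real.arccos x)

/-- The Chebyshev polynomial of the second kind `U_{n-1}`. -/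
def chebU (n : ℕ) : Polynomial ℝ := Polynomial.Chebyshev.U ℝ ((n : ℤ) - 1)

lemma abs_chebSin_le_one (n : ℕ) (x : ℝ) : |chebSin n x| ≤ 1 := Real.abs_sin_le_one _

lemma continuous_chebSin (n : ℕ) : Continuous (chebSin n) := by
  unfold chebSin
  exact Real.continuous_sin.comp (continuous_const.mul Real.continuous_arccos)

lemma chebSin_neg_one (n : ℕ) : chebSin n (-1) = 0 := by
  simp [chebSin, Real.sin_nat_mul_pi]

lemma chebSin_one (n : ℕ) : chebSin n 1 = 0 := by simp [chebSin]

lemma chebU_eval_mul_sin (n : ℕ) (x : ℝ) :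
    (chebU n).eval (Real.cos x) * Real.sin x = Real.sin (n * x) := by
  rw [chebU, Polynomial.Chebyshev.U_real_cos]
  push_cast
  ring_nf

lemma natDegree_chebU_le (n : ℕ) : (chebU n).natDegree ≤ n := by
  unfold chebU
  rcases n with _ | n
  · simp
  · have : (((n + 1 : ℕ) : ℤ) - 1) = (n : ℤ) := by push_cast; ring
    rw [this, Polynomial.Chebyshev.natDegree_U_natCast]
    omega

lemma abs_iterate_derivative_chebU_le (a n : ℕ) {x : ℝ} (hx : |x| ≤ 1) :
    |(Polynomial.derivative^[a] (chebU n)).eval x| ≤ (n : ℝ) ^ (2 * a + 1) := by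
  rcases Nat.eq_zero_or_pos n with rfl | hn
  · simp [chebU]
  have h1 := Polynomial.Chebyshev.abs_iterate_derivative_T_real_le n (a + 1) hx
  have h2 := Polynomial.Chebyshev.iterate_derivative_T_eval_one (R := ℝ) n (a + 1)
  generalize (Polynomial.derivative^[a + 1] (Polynomial.Chebyshev.T ℝ n)).eval 1 = Y at h1 h2
  rw [Function.iterate_succ_apply, Polynomial.Chebyshev.T_derivative_eq_U] at h1
  have h3 : Polynomial.derivative^[a] (((n : ℤ) : Polynomial ℝ) * Polynomial.Chebyshev.U ℝ (n - 1))
      = ((n : ℤ) : Polynomial ℝ) * Polynomial.derivative^[a] (chebU n) := by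
    rw [chebU, Polynomial.iterate_derivative_intCast_mul]
  rw [h3, Polynomial.eval_mul] at h1
  have hn' : (0 : ℝ) < n := by exact_mod_cast hn
  have h4 : Y ≤ (n : ℝ) ^ (2 * (a + 1)) := by
    have hY0 : 0 ≤ Y := (abs_nonneg _).trans h1
    have e1 : (1 : ℝ) ≤ ((∏ l ∈ Finset.range (a + 1), (2 * l + 1) : ℕ) : ℝ) := by
      exact_mod_cast Nat.one_le_iff_ne_zero.2 (Finset.prod_ne_zero_iff.2 fun i _ => by omega)
    have e2 : |∏ l ∈ Finset.range (a + 1), ((n : ℝ) ^ 2 - (l : ℝ) ^ 2)| ≤ (n : ℝ) ^ (2 * (a + 1)) := by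
      by_cases hna : n < a + 1
      · rw [Finset.prod_eq_zero (Finset.mem_range.2 hna) (by ring)]
        simp
      · rw [Finset.abs_prod, pow_mul]
        calc _ ≤ ∏ l ∈ Finset.range (a + 1), ((n : ℝ) ^ 2) := by
              refine Finset.prod_le_prod (fun _ _ => abs_nonneg _) fun l hl => ?_
              have : (l : ℝ) ≤ n := by
                have := Finset.mem_range.1 hl
                exact_mod_cast (by omega : l ≤ n)
              rw [abs_le]
              constructor <;> nlinarith [sq_nonneg (l : ℝ), sq_nonneg (n : ℝ)]
          _ = _ := by simp
    have e3 := (le_abs_self _).trans e2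
    push_cast at h2 e1
    nlinarith
  have h5 := h1.trans h4
  simp only [Int.cast_natCast, Polynomial.eval_natCast, abs_mul, Nat.abs_cast] at h5
  have h6 : (n : ℝ) ^ (2 * (a + 1)) = n * (n : ℝ) ^ (2 * a + 1) := by ring
  rw [h6] at h5
  exact le_of_mul_le_mul_left h5 hn'

/-- `chebSin` has an explicit antiderivative that vanishes at `±1`. -/
lemma hasDerivAt_chebSin_antideriv (n : ℕ) {x : ℝ} (hx : x ∈ Ioo (-1 : ℝ) 1) :
    HasDerivAt (fun x => (chebSin (n + 3) x / (n + 3) - chebSin (n + 1) x / (n + 1)) / 2)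
      (chebSin (n + 2) x) x := by
  have h0 := Real.hasDerivAt_arccos (ne_of_gt hx.1) (ne_of_lt hx.2)
  have h (k : ℕ) : HasDerivAt (chebSin k)
      (Real.cos (k * Real.arccos x) * (k * -(1 / √(1 - x ^ 2)))) x :=
    (h0.const_mul (k : ℝ)).sin
  have hs : 0 < √(1 - x ^ 2) := Real.sqrt_pos.2 (by nlinarith [hx.1, hx.2])
  refine ((((h (n + 3)).div_const ((n : ℝ) + 3)).sub
    ((h (n + 1)).div_const ((n : ℝ) + 1))).div_const 2).congr_deriv ?_
  have e1 : Real.cos ((n + 1 : ℕ) * Real.arccos x) - Real.cos ((n + 3 : ℕ) * Real.arccos x)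
      = 2 * chebSin (n + 2) x * √(1 - x ^ 2) := by
    rw [Real.cos_sub_cos, chebSin, ← Real.sin_arccos]
    push_cast
    rw [show ((n + 1) * Real.arccos x + (n + 3) * Real.arccos x) / 2 = (n + 2) * Real.arccos x by ring,
      show ((n + 1) * Real.arccos x - (n + 3) * Real.arccos x) / 2 = - Real.arccos x by ring,
      Real.sin_neg]
    ring
  have e2 : chebSin (n + 2) x = (Real.cos ((n + 1 : ℕ) * Real.arccos x)
      - Real.cos ((n + 3 : ℕ) * Real.arccos x)) / (2 * √(1 - x ^ 2)) := by
    rw [e1]; field_simp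
  rw [e2]
  have : (n : ℝ) + 1 ≠ 0 := by positivity
  have : (n : ℝ) + 3 ≠ 0 := by positivity
  push_cast
  field_simp
  ring

/-- The closed reference square. -/
def closedSq : Set (ℝ × ℝ) := Icc (-1 : ℝ) 1 ×ˢ Icc (-1 : ℝ) 1

lemma closure_Q2 : closure Q2 = closedSq := by
  rw [Q2, closedSq, closure_prod_eq, closure_Ioo (by norm_num)]

lemma Q2_subset_closedSq : Q2 ⊆ closedSq := prod_mono Ioo_subset_Icc_self Ioo_subset_Icc_self

lemma isOpen_Q2 : IsOpen Q2 := isOpen_Ioo.prod isOpen_Ioo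

lemma measurableSet_Q2 : MeasurableSet Q2 := isOpen_Q2.measurableSet

lemma isCompact_closedSq : IsCompact closedSq := isCompact_Icc.prod isCompact_Icc

lemma uniqueDiffOn_closedSq : UniqueDiffOn ℝ closedSq :=
  (uniqueDiffOn_Icc (by norm_num)).prod (uniqueDiffOn_Icc (by norm_num))

lemma volume_Q2 : volume Q2 = 4 := by
  rw [Q2, Measure.volume_eq_prod, Measure.prod_prod, Real.volume_Ioo]
  rw [← ENNReal.ofReal_mul (by norm_num)]
  norm_num

lemma integrableOn_Q2 {w : ℝ × ℝ → ℝ} (hw : ContinuousOn w closedSq) : IntegrableOn w Q2 :=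
  (hw.integrableOn_compact isCompact_closedSq).mono_set Q2_subset_closedSq

/-- Partial derivative in the first variable relative to the closed reference square. -/
def pdxWithin (w : ℝ × ℝ → ℝ) : ℝ × ℝ → ℝ := fun z => fderivWithin ℝ w closedSq z (1, 0)

lemma ContDiffOn.pdxWithin {w : ℝ × ℝ → ℝ} (hw : ContDiffOn ℝ (⊤ : ℕ∞) w closedSq) :
    ContDiffOn ℝ (⊤ : ℕ∞) (pdxWithin w) closedSq :=
  (hw.fderivWithin uniqueDiffOn_closedSq (by simp)).clm_apply contDiffOn_const

lemma ContDiffOn.iterate_pdxWithin {w : ℝ × ℝ → ℝ} (hw : ContDiffOn ℝ (⊤ : ℕ∞) w closedSq)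
    (k : ℕ) : ContDiffOn ℝ (⊤ : ℕ∞) (_root_.pdxWithin^[k] w) closedSq := by
  induction k with
  | zero => exact hw
  | succ k ih => rw [Function.iterate_succ_apply']; exact ih.pdxWithin

lemma hasDerivAt_pdxWithin {w : ℝ × ℝ → ℝ} (hw : ContDiffOn ℝ (⊤ : ℕ∞) w closedSq) {x y : ℝ}
    (hx : x ∈ Ioo (-1 : ℝ) 1) (hy : y ∈ Icc (-1 : ℝ) 1) :
    HasDerivAt (fun t => w (t, y)) (pdxWithin w (x, y)) x := by
  have h := ((hw.differentiableOn (by simp)) (x, y) ⟨Ioo_subset_Icc_self hx, hy⟩).hasFDerivWithinAt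
  have hl : HasDerivWithinAt (fun t : ℝ => (t, y)) ((1 : ℝ), (0 : ℝ)) (Icc (-1) 1) x :=
    ((hasDerivAt_id x).prodMk (hasDerivAt_const x y)).hasDerivWithinAt
  have hs : MapsTo (fun t : ℝ => (t, y)) (Icc (-1) 1) closedSq := fun t ht => ⟨ht, hy⟩
  exact (h.comp_hasDerivWithinAt x hl hs).hasDerivAt (Icc_mem_nhds hx.1 hx.2)

/-- Partial derivatives of functions agreeing on `Q2` agree on `Q2`. -/
lemma EqOn.pdx {v w : ℝ × ℝ → ℝ} (h : EqOn v w Q2) : EqOn (pdx v) (pdx w) Q2 := by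
  intro z hz
  refine Filter.EventuallyEq.deriv_eq ?_
  filter_upwards [Ioo_mem_nhds hz.1.1 hz.1.2] with t ht using h ⟨ht, hz.2⟩

lemma EqOn.pdy {v w : ℝ × ℝ → ℝ} (h : EqOn v w Q2) : EqOn (pdy v) (pdy w) Q2 := by
  intro z hz
  refine Filter.EventuallyEq.deriv_eq ?_
  filter_upwards [Ioo_mem_nhds hz.2.1 hz.2.2] with t ht using h ⟨hz.1, ht⟩

lemma eqOn_iterate_pdxWithin {w : ℝ × ℝ → ℝ} (hw : ContDiffOn ℝ (⊤ : ℕ∞) w closedSq) (k : ℕ) :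
    EqOn (pdx^[k] w) (pdxWithin^[k] w) Q2 := by
  induction k with
  | zero => exact fun _ _ => rfl
  | succ k ih =>
    rw [Function.iterate_succ_apply', Function.iterate_succ_apply']
    intro z hz
    rw [EqOn.pdx ih hz]
    exact (hasDerivAt_pdxWithin (hw.iterate_pdxWithin k) hz.1 (Ioo_subset_Icc_self hz.2)).deriv

lemma iterate_pdx_comp_swap (w : ℝ × ℝ → ℝ) (k : ℕ) :
    pdx^[k] (w ∘ Prod.swap) = pdy^[k] w ∘ Prod.swap := by
  induction k with
  | zero => rfl
  | succ k ih => rw [Function.iterate_succ_apply', Function.iterate_succ_apply', ih]; rfl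

lemma ContDiffOn.comp_swap {w : ℝ × ℝ → ℝ} (hw : ContDiffOn ℝ (⊤ : ℕ∞) w closedSq) :
    ContDiffOn ℝ (⊤ : ℕ∞) (w ∘ Prod.swap) closedSq :=
  have hs : MapsTo Prod.swap closedSq closedSq := fun _ hz => ⟨hz.2, hz.1⟩
  hw.comp (contDiff_snd.prodMk contDiff_fst).contDiffOn hs

lemma setIntegral_Q2_comp_swap (f : ℝ × ℝ → ℝ) : ∫ z in Q2, f z.swap = ∫ z in Q2, f z :=
  setIntegral_prod_swap (μ := volume) (ν := volume) (Ioo (-1 : ℝ) 1) (Ioo (-1 : ℝ) 1) f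

/-- Coefficients of `w` in the tensor product Chebyshev expansion of the second kind. -/
def chebCoeff (w : ℝ × ℝ → ℝ) (i j : ℕ) : ℝ := ∫ z in Q2, w z * (chebSin i z.1 * chebSin j z.2)

lemma chebCoeff_comp_swap (w : ℝ × ℝ → ℝ) (i j : ℕ) :
    chebCoeff (w ∘ Prod.swap) i j = chebCoeff w j i := by
  unfold chebCoeff
  rw [← setIntegral_Q2_comp_swap]
  simp [mul_comm]

lemma integrableOn_chebCoeff {w : ℝ × ℝ → ℝ} (hw : ContinuousOn w closedSq) (i j : ℕ) :
    IntegrableOn (fun z => w z * (chebSin i z.1 * chebSin j z.2)) Q2 :=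
  integrableOn_Q2 (hw.mul (((continuous_chebSin i).comp continuous_fst).mul
    ((continuous_chebSin j).comp continuous_snd)).continuousOn)

lemma abs_chebCoeff_le {w : ℝ × ℝ → ℝ} (hw : ContinuousOn w closedSq) (i j : ℕ) :
    |chebCoeff w i j| ≤ ∫ z in Q2, |w z| := by
  refine (abs_integral_le_integral_abs).trans ?_
  refine integral_mono (integrableOn_chebCoeff hw i j).abs (integrableOn_Q2 hw.abs) fun z => ?_
  simp only [abs_mul]
  have := mul_le_mul (abs_chebSin_le_one i z.1) (abs_chebSin_le_one j z.2) (abs_nonneg _) zero_le_one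
  nlinarith [abs_nonneg (w z)]

lemma setIntegral_Ioo_eq_interval (f : ℝ → ℝ) :
    ∫ x in Ioo (-1 : ℝ) 1, f x = ∫ x in (-1 : ℝ)..1, f x := by
  rw [intervalIntegral.integral_of_le (by norm_num), integral_Ioc_eq_integral_Ioo]

lemma chebCoeff_succ_succ {w : ℝ × ℝ → ℝ} (hw : ContDiffOn ℝ (⊤ : ℕ∞) w closedSq) (n j : ℕ) :
    chebCoeff w (n + 2) j = (chebCoeff (pdxWithin w) (n + 1) j / (n + 1)
      - chebCoeff (pdxWithin w) (n + 3) j / (n + 3)) / 2 := by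
  have hc := hw.continuousOn
  have hc' := hw.pdxWithin.continuousOn
  let A : ℝ → ℝ := fun x => (chebSin (n + 3) x / (n + 3) - chebSin (n + 1) x / (n + 1)) / 2
  have hA : Continuous A := (((continuous_chebSin _).div_const _).sub
    ((continuous_chebSin _).div_const _)).div_const _
  have hslice {u : ℝ × ℝ → ℝ} (hu : ContinuousOn u closedSq) {y : ℝ} (hy : y ∈ Ioo (-1 : ℝ) 1) :
      ContinuousOn (fun x => u (x, y)) (uIcc (-1 : ℝ) 1) := by
    rw [uIcc_of_le (by norm_num)]
    exact hu.comp (by fun_prop) fun x hx => ⟨hx, Ioo_subset_Icc_self hy⟩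
  have key : chebCoeff w (n + 2) j = - ∫ z in Q2, pdxWithin w z * (A z.1 * chebSin j z.2) := by
    have hI := integrableOn_chebCoeff hc (n + 2) j
    have hI' : IntegrableOn (fun z => pdxWithin w z * (A z.1 * chebSin j z.2)) Q2 :=
      integrableOn_Q2 (hc'.mul ((hA.comp continuous_fst).mul
        ((continuous_chebSin j).comp continuous_snd)).continuousOn)
    rw [chebCoeff, ← setIntegral_Q2_comp_swap,
      ← setIntegral_Q2_comp_swap fun z => pdxWithin w z * (A z.1 * chebSin j z.2)]
    have sw {f : ℝ × ℝ → ℝ} (hf : IntegrableOn f Q2) : IntegrableOn (fun z => f z.swap) Q2 := by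
      rw [IntegrableOn, Q2, Measure.volume_eq_prod, ← Measure.prod_restrict] at hf ⊢
      exact hf.swap
    have e1 := setIntegral_prod (μ := volume) (ν := volume) _ (sw hI)
    have e2 := setIntegral_prod (μ := volume) (ν := volume) _ (sw hI')
    refine e1.trans (Eq.trans ?_ (congrArg Neg.neg e2).symm)
    rw [← integral_neg]
    refine setIntegral_congr_fun measurableSet_Ioo fun y hy => ?_
    simp only [Prod.swap_prod_mk]
    have hI : ∫ x in (-1 : ℝ)..1, w (x, y) * chebSin (n + 2) x
        = - ∫ x in (-1 : ℝ)..1, pdxWithin w (x, y) * A x := by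
      rw [intervalIntegral.integral_mul_deriv_eq_deriv_mul_of_hasDerivAt (hslice hc hy)
        hA.continuousOn (u' := fun x => pdxWithin w (x, y)) (v := A)]
      · simp [A, chebSin_one, chebSin_neg_one]
      · intro x hx
        rw [min_eq_left (by norm_num), max_eq_right (by norm_num)] at hx
        exact hasDerivAt_pdxWithin hw hx (Ioo_subset_Icc_self hy)
      · intro x hx
        rw [min_eq_left (by norm_num), max_eq_right (by norm_num)] at hx
        exact hasDerivAt_chebSin_antideriv n hx
      · exact (hslice hc' hy).intervalIntegrable
      · exact (continuous_chebSin _).intervalIntegrable _ _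
    simp only [← mul_assoc, integral_mul_const, setIntegral_Ioo_eq_interval]
    rw [hI]
    ring
  rw [key]
  have h1 := (integrableOn_chebCoeff hc' (n + 1) j).div_const ((n : ℝ) + 1)
  have h3 := (integrableOn_chebCoeff hc' (n + 3) j).div_const ((n : ℝ) + 3)
  unfold chebCoeff
  rw [← integral_div, ← integral_div, ← integral_sub h1 h3, ← integral_div, ← integral_neg]
  refine integral_congr_ae (Filter.Eventually.of_forall fun z => ?_)
  simp only [A]
  ring

/-- Iterated integration by parts bounds the Chebyshev coefficients. -/
lemma abs_chebCoeff_le_div_pow {m : ℝ} (hm : 0 < m) (j k : ℕ) :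
    ∀ {w : ℝ × ℝ → ℝ}, ContDiffOn ℝ (⊤ : ℕ∞) w closedSq → ∀ {i : ℕ}, m + k ≤ i →
      |chebCoeff w i j| ≤ (∫ z in Q2, |pdxWithin^[k] w z|) / m ^ k := by
  induction k with
  | zero =>
    intro w hw i _
    simpa using abs_chebCoeff_le hw.continuousOn i j
  | succ k ih =>
    intro w hw i hi
    push_cast at hi
    have h2 : 2 ≤ i := by
      have : (1 : ℝ) < i := by linarith [(k.cast_nonneg : (0 : ℝ) ≤ k)]
      exact_mod_cast this
    obtain ⟨n, rfl⟩ := Nat.exists_eq_add_of_le' h2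
    push_cast at hi
    have b1 := ih hw.pdxWithin (i := n + 1) (by push_cast; linarith)
    have b3 := ih hw.pdxWithin (i := n + 3) (by push_cast; linarith)
    rw [chebCoeff_succ_succ hw, Function.iterate_succ_apply]
    set B := (∫ z in Q2, |pdxWithin^[k] (pdxWithin w) z|) / m ^ k with hB
    have hk : (0 : ℝ) ≤ k := k.cast_nonneg
    have c1 : |chebCoeff (pdxWithin w) (n + 1) j / (n + 1)| ≤ B / m := by
      rw [abs_div, abs_of_pos (by positivity : (0 : ℝ) < n + 1)]
      exact div_le_div₀ ((abs_nonneg _).trans b1) b1 hm (by linarith)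
    have c3 : |chebCoeff (pdxWithin w) (n + 3) j / (n + 3)| ≤ B / m := by
      rw [abs_div, abs_of_pos (by positivity : (0 : ℝ) < n + 3)]
      exact div_le_div₀ ((abs_nonneg _).trans b3) b3 hm (by linarith)
    have e : (∫ z in Q2, |pdxWithin^[k] (pdxWithin w) z|) / m ^ (k + 1) = B / m := by
      rw [hB, pow_succ, div_div]
    rw [e, abs_le]
    rw [abs_le] at c1 c3
    constructor <;> linarith [c1.1, c1.2, c3.1, c3.2]

lemma setIntegral_abs_le_of_sq_le {g : ℝ × ℝ → ℝ} (hg : ContinuousOn g closedSq) {t : ℝ}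
    (ht : 0 < t) (h : ∫ z in Q2, g z ^ 2 ≤ t ^ 2) : ∫ z in Q2, |g z| ≤ 5 * t := by
  have hs : IntegrableOn (fun z => g z ^ 2 / t) Q2 := integrableOn_Q2 ((hg.pow 2).div_const t)
  have hi : IntegrableOn (fun z => t + g z ^ 2 / t) Q2 :=
    (integrableOn_Q2 continuousOn_const).add hs
  calc ∫ z in Q2, |g z| ≤ ∫ z in Q2, (t + g z ^ 2 / t) := by
        refine integral_mono (integrableOn_Q2 hg.abs) hi fun z => ?_
        have : |g z| * t ≤ t ^ 2 + |g z| ^ 2 := by nlinarith [sq_nonneg (|g z| - t), sq_nonneg |g z|]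
        have e : t + g z ^ 2 / t = (t ^ 2 + |g z| ^ 2) / t := by rw [sq_abs]; field_simp
        rwa [e, le_div_iff₀ ht]
    _ = 4 * t + (∫ z in Q2, g z ^ 2) / t := by
        rw [integral_add (integrableOn_Q2 continuousOn_const) hs, integral_div]
        simp [Measure.real, volume_Q2]
    _ ≤ 4 * t + t ^ 2 / t := by gcongr
    _ = 5 * t := by field_simp; ring

lemma setIntegral_Dab_sq_le_sobQ (a b : ℕ) (v : ℝ × ℝ → ℝ) :
    ∫ z in Q2, Dab a b v z ^ 2 ≤ sobQ (a + b) v := by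
  have hn (a b : ℕ) : 0 ≤ ∫ z in Q2, Dab a b v z ^ 2 := integral_nonneg fun _ => sq_nonneg _
  unfold sobQ sobOn
  refine le_trans ?_ (Finset.single_le_sum (fun i _ => Finset.sum_nonneg fun j _ => hn i j)
    (Finset.mem_range.2 (by omega : a < a + b + 1)))
  exact Finset.single_le_sum (f := fun b => ∫ z in Q2, Dab a b v z ^ 2) (fun j _ => hn a j)
    (Finset.mem_range.2 (by omega))

lemma abs_chebCoeff_le_geometric {w : ℝ × ℝ → ℝ} (hw : ContDiffOn ℝ (⊤ : ℕ∞) w closedSq)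
    {C d : ℝ} (hC : 0 < C) (hd : 0 < d)
    (h : ∀ s : ℕ, ∫ z in Q2, (pdx^[s] w z) ^ 2 ≤ (C * d ^ s * (Nat.factorial s : ℝ)) ^ 2)
    {p : ℕ} (hp : 2 * d + 1 ≤ p) (i j : ℕ) :
    |chebCoeff w i j| ≤ 5 * C * (1 / 2) ^ (i / p) := by
  set k := i / p with hk
  have hL (k : ℕ) : ∫ z in Q2, |pdxWithin^[k] w z| ≤ 5 * (C * d ^ k * (Nat.factorial k : ℝ)) := by
    refine setIntegral_abs_le_of_sq_le (hw.iterate_pdxWithin k).continuousOn (by positivity) ?_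
    refine le_trans (le_of_eq (setIntegral_congr_fun measurableSet_Q2 fun z hz => ?_)) (h k)
    simp only [eqOn_iterate_pdxWithin hw k hz]
  rcases Nat.eq_zero_or_pos k with h0 | h0
  · rw [h0]
    have h1 := hL 0
    have h2 := abs_chebCoeff_le hw.continuousOn i j
    simp only [Function.iterate_zero, id, pow_zero, Nat.factorial_zero, Nat.cast_one, mul_one]
      at h1 ⊢
    linarith
  have hk0 : (0 : ℝ) < k := by exact_mod_cast h0
  have hp1 : (0 : ℝ) < p - 1 := by linarith
  have hm : (0 : ℝ) < k * (p - 1) := by positivity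
  have hki : (k : ℝ) * p ≤ i := by exact_mod_cast Nat.div_mul_le_self i p
  refine (abs_chebCoeff_le_div_pow hm j k hw (by linarith)).trans ?_
  rw [div_le_iff₀ (by positivity)]
  have hf : (Nat.factorial k : ℝ) ≤ (k : ℝ) ^ k := by exact_mod_cast Nat.factorial_le_pow k
  have hq : d ^ k * (k : ℝ) ^ k ≤ (1 / 2) ^ k * (k * (p - 1)) ^ k := by
    rw [← mul_pow, ← mul_pow]
    refine pow_le_pow_left₀ (by positivity) ?_ k
    nlinarith
  calc _ ≤ 5 * (C * d ^ k * (Nat.factorial k : ℝ)) := hL k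
    _ ≤ 5 * (C * d ^ k * (k : ℝ) ^ k) := by gcongr
    _ = 5 * C * (d ^ k * (k : ℝ) ^ k) := by ring
    _ ≤ 5 * C * ((1 / 2) ^ k * (k * (p - 1)) ^ k) := by gcongr
    _ = _ := by ring

/-- A fourth root of the base of geometric decay of the Chebyshev coefficients. -/
lemma exists_half_pow_div_le {p : ℕ} (hp : 0 < p) :
    ∃ τ : ℝ, 0 < τ ∧ τ < 1 ∧ ∀ i : ℕ, (1 / 2 : ℝ) ^ (i / p) ≤ 2 * (τ ^ 4) ^ i := by
  refine ⟨(1 / 2 : ℝ) ^ (1 / (4 * p : ℝ)), by positivity,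
    Real.rpow_lt_one (by norm_num) (by norm_num) (by positivity), fun i => ?_⟩
  have hp' : (0 : ℝ) < p := by exact_mod_cast hp
  have e : (((1 / 2 : ℝ) ^ (1 / (4 * p : ℝ))) ^ 4) ^ i = (1 / 2 : ℝ) ^ ((i : ℝ) / p) := by
    rw [← pow_mul, ← Real.rpow_natCast, ← Real.rpow_mul (by norm_num)]
    congr 1
    push_cast
    field_simp
  have e2 : 2 * (1 / 2 : ℝ) ^ ((i : ℝ) / p) = (1 / 2 : ℝ) ^ ((i : ℝ) / p - 1) := by
    rw [Real.rpow_sub (by norm_num), Real.rpow_one]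
    ring
  rw [e, e2, ← Real.rpow_natCast]
  refine Real.rpow_le_rpow_of_exponent_ge (by norm_num) (by norm_num) ?_
  have h := Nat.lt_div_mul_add (a := i) hp
  have h' : (i : ℝ) < (i / p : ℕ) * p + p := by exact_mod_cast h
  rw [sub_le_iff_le_add, div_le_iff₀ hp']
  linarith

/-- Sine series of `F(cos θ) sin θ`. -/
lemma hasSum_chebSin {F : ℝ → ℝ} (hF : ContinuousOn F (Icc (-1) 1))
    (hs : Summable fun n : ℕ => ∫ x in (-1 : ℝ)..1, F x * chebSin n x) (θ : ℝ) :
    HasSum (fun n : ℕ => 2 / Real.pi * (∫ x in (-1 : ℝ)..1, F x * chebSin n x) * Real.sin (n * θ))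
      (F (Real.cos θ) * Real.sin θ) := by
  have hpi := Real.pi_pos
  have : Fact (0 < 2 * Real.pi) := ⟨by positivity⟩
  set β : ℕ → ℝ := fun n => ∫ x in (-1 : ℝ)..1, F x * chebSin n x with hβ
  let G : ℝ → ℝ := fun θ => F (Real.cos θ) * Real.sin θ
  have hGc : Continuous G := (hF.comp_continuous Real.continuous_cos
    fun x => ⟨Real.neg_one_le_cos x, Real.cos_le_one x⟩).mul Real.continuous_sin
  have hGp : Function.Periodic (fun x => (G x : ℂ)) (2 * Real.pi) := fun x => by
    simp [G, Real.cos_add_two_pi, Real.sin_add_two_pi]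
  have hGodd (x : ℝ) : G (-x) = -G x := by simp [G]
  let g : C(AddCircle (2 * Real.pi), ℂ) :=
    ⟨hGp.lift, continuous_coinduced_dom.mpr (Complex.continuous_ofReal.comp hGc)⟩
  have hg (x : ℝ) : g (x : AddCircle (2 * Real.pi)) = (G x : ℂ) := hGp.lift_coe x
  have hβG (n : ℕ) : β n = ∫ θ in (0 : ℝ)..Real.pi, G θ * Real.sin (n * θ) := by
    have h := intervalIntegral.integral_comp_mul_deriv' (a := 0) (b := Real.pi) (f := Real.cos)
      (f' := fun x => -Real.sin x) (g := fun x => F x * chebSin n x)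
      (fun x _ => Real.hasDerivAt_cos x) Real.continuous_sin.neg.continuousOn
      ((hF.mul (continuous_chebSin n).continuousOn).mono (by
        rintro _ ⟨x, _, rfl⟩
        exact ⟨Real.neg_one_le_cos x, Real.cos_le_one x⟩))
    rw [Real.cos_zero, Real.cos_pi, intervalIntegral.integral_symm (-1) 1] at h
    rw [show β n = _ from neg_eq_iff_eq_neg.1 h.symm, ← intervalIntegral.integral_neg]
    refine intervalIntegral.integral_congr fun x hx => ?_
    rw [uIcc_of_le hpi.le] at hx
    simp only [Function.comp, chebSin, Real.arccos_cos hx.1 hx.2, G]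
    ring
  have hcoef (n : ℤ) : fourierCoeff g n
      = -Complex.I / Real.pi * ((∫ θ in (0 : ℝ)..Real.pi, G θ * Real.sin (n * θ) : ℝ) : ℂ) := by
    rw [fourierCoeff_eq_intervalIntegral g n (-Real.pi)]
    have e1 : (-Real.pi + 2 * Real.pi) = Real.pi := by ring
    have e2 (x : ℝ) : (@fourier (2 * Real.pi) (-n) x : ℂ)
        = Real.cos (n * x) - Real.sin (n * x) * Complex.I := by
      rw [fourier_coe_apply]
      have : (2 * Real.pi * Complex.I * (-n : ℤ) * x / (2 * Real.pi : ℝ) : ℂ)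
          = ((-(n * x) : ℝ) : ℂ) * Complex.I := by
        have : (Real.pi : ℂ) ≠ 0 := by exact_mod_cast hpi.ne'
        push_cast
        field_simp
      rw [this, Complex.exp_mul_I, ← Complex.ofReal_cos, ← Complex.ofReal_sin, Real.cos_neg,
        Real.sin_neg]
      push_cast
      ring
    have hc : Continuous fun x : ℝ => (@fourier (2 * Real.pi) (-n) x : ℂ) • g x := by
      simp only [hg, e2]
      fun_prop
    rw [e1, ← intervalIntegral.integral_add_adjacent_intervals (b := 0)
      (hc.intervalIntegrable _ _) (hc.intervalIntegrable _ _)]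
    have e3 : ∫ x in (-Real.pi)..0, (@fourier (2 * Real.pi) (-n) x : ℂ) • g x
        = ∫ x in (0 : ℝ)..Real.pi, (@fourier (2 * Real.pi) (-n) ((-x : ℝ) : AddCircle _) : ℂ)
          • g ((-x : ℝ) : AddCircle _) := by
      rw [intervalIntegral.integral_comp_neg
        (fun x : ℝ => (@fourier (2 * Real.pi) (-n) x : ℂ) • g (x : AddCircle _)), neg_zero]
    have hc2 : Continuous fun x : ℝ =>
        (@fourier (2 * Real.pi) (-n) ((-x : ℝ) : AddCircle _) : ℂ) • g ((-x : ℝ) : AddCircle _) :=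
      hc.comp continuous_neg
    rw [e3, ← intervalIntegral.integral_add (hc2.intervalIntegrable _ _) (hc.intervalIntegrable _ _),
      ← intervalIntegral.integral_ofReal, ← intervalIntegral.integral_const_mul,
      Complex.real_smul, ← intervalIntegral.integral_const_mul]
    refine intervalIntegral.integral_congr fun x _ => ?_
    simp only [hg, e2, hGodd, mul_neg, Real.cos_neg, Real.sin_neg, smul_eq_mul]
    have : (Real.pi : ℂ) ≠ 0 := by exact_mod_cast hpi.ne'
    push_cast
    field_simp
    ring
  have hcoefN (n : ℕ) : fourierCoeff g n = -Complex.I / Real.pi * (β n : ℂ) := by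
    rw [hcoef, hβG]
    simp
  have hcoefNeg (n : ℕ) : fourierCoeff g (-(n : ℤ)) = -(-Complex.I / Real.pi * (β n : ℂ)) := by
    rw [hcoef, hβG]
    simp
  have hsum : Summable (fourierCoeff g) := by
    have hs' : Summable fun n : ℕ => -Complex.I / Real.pi * (β n : ℂ) :=
      (Complex.ofRealCLM.summable hs).mul_left _
    refine Summable.of_nat_of_neg ?_ ?_
    · simpa only [hcoefN] using hs'
    · simpa only [hcoefNeg] using hs'.neg
  have h := (has_pointwise_sum_fourier_series_of_summable hsum (θ : AddCircle _)).nat_add_neg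
  have hβ0 : β 0 = 0 := by simp [hβ, chebSin]
  have h00 : fourierCoeff g 0 = 0 := by simpa [hβ0] using hcoefN 0
  rw [hg, h00, zero_smul, add_zero] at h
  rw [← Complex.hasSum_ofReal]
  convert h using 1
  funext n
  rw [hcoefN, hcoefNeg, fourier_coe_apply, fourier_coe_apply]
  have hπ : (Real.pi : ℂ) ≠ 0 := by exact_mod_cast hpi.ne'
  have a1 : (2 * Real.pi * Complex.I * (n : ℤ) * θ / (2 * Real.pi : ℝ) : ℂ)
      = (n * θ : ℂ) * Complex.I := by
    push_cast
    field_simp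
  have a2 : (2 * Real.pi * Complex.I * (-(n : ℤ) : ℤ) * θ / (2 * Real.pi : ℝ) : ℂ)
      = -(n * θ : ℂ) * Complex.I := by
    push_cast
    field_simp
  rw [a1, a2, Complex.exp_mul_I, Complex.exp_mul_I, Complex.cos_neg, Complex.sin_neg]
  push_cast
  simp only [smul_eq_mul]
  linear_combination (2 / (Real.pi : ℂ) * (β n : ℂ) * Complex.sin (n * θ)) * Complex.I_sq

lemma hasSum_chebCoeff_of_continuous {w : ℝ × ℝ → ℝ} (hw : Continuous w)
    (hs : Summable fun q : ℕ × ℕ => chebCoeff w q.1 q.2) (θ : ℝ) {φ : ℝ} (hφ : Real.sin φ ≠ 0) :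
    HasSum (fun q : ℕ × ℕ => 2 / Real.pi * (2 / Real.pi * chebCoeff w q.1 q.2 *
        Real.sin (q.2 * φ)) * Real.sin (q.1 * θ))
      (w (Real.cos θ, Real.cos φ) * Real.sin θ * Real.sin φ) := by
  let b : ℕ → ℝ → ℝ := fun i y => ∫ x in (-1 : ℝ)..1, w (x, y) * chebSin i x
  have hb (i : ℕ) : Continuous (b i) := by
    refine intervalIntegral.continuous_parametric_intervalIntegral_of_continuous'
      (f := fun y x => w (x, y) * chebSin i x) ?_ _ _
    exact (hw.comp (continuous_snd.prodMk continuous_fst)).mul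
      ((continuous_chebSin i).comp continuous_snd)
  have hcoef (i j : ℕ) : chebCoeff w i j = ∫ y in (-1 : ℝ)..1, b i y * chebSin j y := by
    rw [← chebCoeff_comp_swap, chebCoeff]
    have hI := integrableOn_chebCoeff (hw.comp continuous_swap).continuousOn j i
    refine (setIntegral_prod (μ := volume) (ν := volume) _ hI).trans ?_
    rw [← setIntegral_Ioo_eq_interval]
    refine setIntegral_congr_fun measurableSet_Ioo fun y _ => ?_
    simp only [b, ← setIntegral_Ioo_eq_interval, ← integral_mul_const]
    refine setIntegral_congr_fun measurableSet_Ioo fun x _ => ?_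
    simp only [Function.comp, Prod.swap_prod_mk]
    ring
  have hinner (i : ℕ) : HasSum (fun j : ℕ => 2 / Real.pi * chebCoeff w i j * Real.sin (j * φ))
      (b i (Real.cos φ) * Real.sin φ) := by
    have h := hasSum_chebSin (F := b i) (hb i).continuousOn
      (by simpa only [← hcoef] using hs.prod_factor i) φ
    simpa only [← hcoef] using h
  have hsum1 : Summable fun q : ℕ × ℕ => 2 / Real.pi * chebCoeff w q.1 q.2 * Real.sin (q.2 * φ) := by
    refine Summable.of_norm_bounded (hs.mul_left (2 / Real.pi)).norm fun q => ?_
    rw [norm_mul]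
    exact mul_le_of_le_one_right (norm_nonneg _) (Real.abs_sin_le_one _)
  have hsum2 : Summable fun q : ℕ × ℕ => 2 / Real.pi * (2 / Real.pi * chebCoeff w q.1 q.2 *
      Real.sin (q.2 * φ)) * Real.sin (q.1 * θ) := by
    refine Summable.of_norm_bounded (hsum1.mul_left (2 / Real.pi)).norm fun q => ?_
    rw [norm_mul]
    exact mul_le_of_le_one_right (norm_nonneg _) (Real.abs_sin_le_one _)
  have hbs : Summable fun i : ℕ => b i (Real.cos φ) := by
    have := (hsum1.hasSum.prod_fiberwise hinner).summable
    exact (summable_mul_right_iff hφ).1 this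
  have houter := (hasSum_chebSin (F := fun x => w (x, Real.cos φ))
    (hw.comp (by fun_prop)).continuousOn hbs θ).mul_right (Real.sin φ)
  have hfib := hsum2.hasSum.prod_fiberwise
    fun i => ((hinner i).mul_left (2 / Real.pi)).mul_right (Real.sin (i * θ))
  have heq := hfib.unique (by
    refine (congrArg (HasSum · _) (funext fun i => ?_)).mpr houter
    change 2 / Real.pi * (b i (Real.cos φ) * Real.sin φ) * Real.sin (i * θ) =
      2 / Real.pi * b i (Real.cos φ) * Real.sin (i * θ) * Real.sin φ
    ring)
  exact heq ▸ hsum2.hasSum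

/-- Pointwise tensor product Chebyshev expansion on the open square. -/
lemma hasSum_chebU {w : ℝ × ℝ → ℝ} (hw : ContinuousOn w closedSq)
    (hs : Summable fun q : ℕ × ℕ => chebCoeff w q.1 q.2) {z : ℝ × ℝ} (hz : z ∈ Q2) :
    HasSum (fun q : ℕ × ℕ => (2 / Real.pi) ^ 2 * chebCoeff w q.1 q.2 *
      ((chebU q.1).eval z.1 * (chebU q.2).eval z.2)) (w z) := by
  let cl : ℝ → ℝ := fun x => max (-1) (min x 1)
  have hcl (x : ℝ) : cl x ∈ Icc (-1 : ℝ) 1 := ⟨le_max_left _ _, max_le (by norm_num) (min_le_right _ _)⟩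
  have hcl' {x : ℝ} (hx : x ∈ Ioo (-1 : ℝ) 1) : cl x = x := by
    simp only [cl, min_eq_left hx.2.le, max_eq_right hx.1.le]
  let w' : ℝ × ℝ → ℝ := fun z => w (cl z.1, cl z.2)
  have hw' : Continuous w' := hw.comp_continuous (by fun_prop) fun z => ⟨hcl _, hcl _⟩
  have hww {z : ℝ × ℝ} (hz : z ∈ Q2) : w' z = w z := by
    simp only [w', hcl' hz.1, hcl' hz.2]
  have hco (i j : ℕ) : chebCoeff w' i j = chebCoeff w i j :=
    setIntegral_congr_fun measurableSet_Q2 fun z hz => by simp only [hww hz]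
  have hsin {x : ℝ} (hx : x ∈ Ioo (-1 : ℝ) 1) : Real.sin (Real.arccos x) ≠ 0 := by
    rw [Real.sin_arccos]
    exact (Real.sqrt_pos.2 (by nlinarith [hx.1, hx.2])).ne'
  have h := hasSum_chebCoeff_of_continuous hw' (by simpa only [hco] using hs)
    (Real.arccos z.1) (hsin hz.2)
  rw [Real.cos_arccos hz.1.1.le hz.1.2.le, Real.cos_arccos hz.2.1.le hz.2.2.le, hww hz] at h
  have h1 := hsin hz.1
  have h2 := hsin hz.2
  convert! h.mul_right ((Real.sin (Real.arccos z.1))⁻¹ * (Real.sin (Real.arccos z.2))⁻¹) using 1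
  · funext q
    rw [hco, ← chebU_eval_mul_sin, ← chebU_eval_mul_sin, Real.cos_arccos hz.1.1.le hz.1.2.le,
      Real.cos_arccos hz.2.1.le hz.2.2.le]
    field_simp
  · field_simp

/-- The termwise `(a, b)`-derivative of the double Chebyshev series with coefficients `c`. -/
def chebSeries (c : ℕ × ℕ → ℝ) (a b : ℕ) (z : ℝ × ℝ) : ℝ :=
  ∑' q : ℕ × ℕ, c q * ((Polynomial.derivative^[a] (chebU q.1)).eval z.1 *
    (Polynomial.derivative^[b] (chebU q.2)).eval z.2)

section chebSeries

variable {c : ℕ × ℕ → ℝ} {A τ : ℝ}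

lemma summable_geometric_mul_pow (hτ0 : 0 < τ) (hτ1 : τ < 1) (a : ℕ) :
    Summable fun n : ℕ => τ ^ n * (n : ℝ) ^ (2 * a + 1) := by
  simpa only [mul_comm] using summable_pow_mul_geometric_of_norm_lt_one (2 * a + 1)
    (r := τ) (by rwa [Real.norm_of_nonneg hτ0.le])

lemma summable_chebSeries_bound (hτ0 : 0 < τ) (hτ1 : τ < 1) (A : ℝ) (a b : ℕ) :
    Summable fun q : ℕ × ℕ =>
      A * ((τ ^ q.1 * (q.1 : ℝ) ^ (2 * a + 1)) * (τ ^ q.2 * (q.2 : ℝ) ^ (2 * b + 1))) :=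
  ((summable_geometric_mul_pow hτ0 hτ1 a).mul_of_nonneg (summable_geometric_mul_pow hτ0 hτ1 b)
    (fun _ => by positivity) fun _ => by positivity).mul_left A

lemma norm_chebSeries_term_le (hc : ∀ q, |c q| ≤ A * (τ ^ q.1 * τ ^ q.2)) (a b : ℕ)
    {x y : ℝ} (hx : x ∈ Ioo (-1 : ℝ) 1) (hy : y ∈ Ioo (-1 : ℝ) 1) (q : ℕ × ℕ) :
    ‖c q * ((Polynomial.derivative^[a] (chebU q.1)).eval x *
      (Polynomial.derivative^[b] (chebU q.2)).eval y)‖ ≤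
      A * ((τ ^ q.1 * (q.1 : ℝ) ^ (2 * a + 1)) * (τ ^ q.2 * (q.2 : ℝ) ^ (2 * b + 1))) := by
  have h1 := abs_iterate_derivative_chebU_le a q.1 (abs_le.2 ⟨hx.1.le, hx.2.le⟩)
  have h2 := abs_iterate_derivative_chebU_le b q.2 (abs_le.2 ⟨hy.1.le, hy.2.le⟩)
  rw [Real.norm_eq_abs, abs_mul, abs_mul]
  calc _ ≤ (A * (τ ^ q.1 * τ ^ q.2)) * ((q.1 : ℝ) ^ (2 * a + 1) * (q.2 : ℝ) ^ (2 * b + 1)) :=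
        mul_le_mul (hc q) (mul_le_mul h1 h2 (abs_nonneg _) (by positivity)) (by positivity)
          ((abs_nonneg _).trans (hc q))
    _ = _ := by ring

lemma abs_chebSeries_le (hτ0 : 0 < τ) (hτ1 : τ < 1) (hc : ∀ q, |c q| ≤ A * (τ ^ q.1 * τ ^ q.2))
    (a b : ℕ) {z : ℝ × ℝ} (hz : z ∈ Q2) :
    |chebSeries c a b z| ≤ A * ((∑' n : ℕ, τ ^ n * (n : ℝ) ^ (2 * a + 1)) *
      ∑' n : ℕ, τ ^ n * (n : ℝ) ^ (2 * b + 1)) := by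
  rw [(summable_geometric_mul_pow hτ0 hτ1 a).tsum_mul_tsum (summable_geometric_mul_pow hτ0 hτ1 b)
    ((summable_geometric_mul_pow hτ0 hτ1 a).mul_of_nonneg (summable_geometric_mul_pow hτ0 hτ1 b)
      (fun _ => by positivity) fun _ => by positivity), ← tsum_mul_left]
  exact tsum_of_norm_bounded (summable_chebSeries_bound hτ0 hτ1 A a b).hasSum
    (norm_chebSeries_term_le hc a b hz.1 hz.2)

lemma pdx_chebSeries (hτ0 : 0 < τ) (hτ1 : τ < 1) (hc : ∀ q, |c q| ≤ A * (τ ^ q.1 * τ ^ q.2))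
    (a b : ℕ) : EqOn (pdx (chebSeries c a b)) (chebSeries c (a + 1) b) Q2 := by
  intro z hz
  refine (hasDerivAt_tsum_of_isPreconnected (summable_chebSeries_bound hτ0 hτ1 A (a + 1) b)
    isOpen_Ioo isPreconnected_Ioo (fun q x _ => ?_)
    (fun q x hx => norm_chebSeries_term_le hc (a + 1) b hx hz.2 q) hz.1
    (Summable.of_norm_bounded (summable_chebSeries_bound hτ0 hτ1 A a b)
      (norm_chebSeries_term_le hc a b hz.1 hz.2)) hz.1).deriv
  rw [Function.iterate_succ_apply']
  exact (((Polynomial.derivative^[a] (chebU q.1)).hasDerivAt x).mul_const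
    ((Polynomial.derivative^[b] (chebU q.2)).eval z.2)).const_mul (c q)

lemma pdy_chebSeries (hτ0 : 0 < τ) (hτ1 : τ < 1) (hc : ∀ q, |c q| ≤ A * (τ ^ q.1 * τ ^ q.2))
    (a b : ℕ) : EqOn (pdy (chebSeries c a b)) (chebSeries c a (b + 1)) Q2 := by
  intro z hz
  refine (hasDerivAt_tsum_of_isPreconnected (summable_chebSeries_bound hτ0 hτ1 A a (b + 1))
    isOpen_Ioo isPreconnected_Ioo (fun q y _ => ?_)
    (fun q y hy => norm_chebSeries_term_le hc a (b + 1) hz.1 hy q) hz.2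
    (Summable.of_norm_bounded (summable_chebSeries_bound hτ0 hτ1 A a b)
      (norm_chebSeries_term_le hc a b hz.1 hz.2)) hz.2).deriv
  rw [Function.iterate_succ_apply']
  exact (((Polynomial.derivative^[b] (chebU q.2)).hasDerivAt y).const_mul
    ((Polynomial.derivative^[a] (chebU q.1)).eval z.1)).const_mul (c q)

lemma Dab_eqOn_chebSeries (hτ0 : 0 < τ) (hτ1 : τ < 1)
    (hc : ∀ q, |c q| ≤ A * (τ ^ q.1 * τ ^ q.2)) {u : ℝ × ℝ → ℝ}
    (hu : EqOn u (chebSeries c 0 0) Q2) (a b : ℕ) : EqOn (Dab a b u) (chebSeries c a b) Q2 := by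
  unfold Dab
  induction a with
  | zero =>
    induction b with
    | zero => exact hu
    | succ b ih =>
      simp only [Function.iterate_zero, id, Function.iterate_succ_apply'] at ih ⊢
      exact (EqOn.pdy ih).trans (pdy_chebSeries hτ0 hτ1 hc 0 b)
  | succ a ih =>
    rw [Function.iterate_succ_apply']
    exact (EqOn.pdx ih).trans (pdx_chebSeries hτ0 hτ1 hc a b)

end chebSeries

lemma sobQ_le_of_abs_Dab_le {u : ℝ × ℝ → ℝ} {B : ℝ}
    (h : ∀ a ≤ 2, ∀ b ≤ 2, ∀ z ∈ Q2, |Dab a b u z| ≤ B) {m : ℕ} (hm : m ≤ 2) :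
    sobQ m u ≤ 36 * B ^ 2 := by
  have hI (a : ℕ) (ha : a ≤ 2) (b : ℕ) (hb : b ≤ 2) : ∫ z in Q2, Dab a b u z ^ 2 ≤ 4 * B ^ 2 := by
    have h1 := norm_setIntegral_le_of_norm_le_const (μ := volume) (s := Q2) (C := B ^ 2)
      (f := fun z => Dab a b u z ^ 2) (by simp [volume_Q2]) fun z hz => by
        rw [norm_pow]
        exact pow_le_pow_left₀ (norm_nonneg _) (h a ha b hb z hz) 2
    have h2 := (le_abs_self _).trans h1
    simp only [Measure.real, volume_Q2, ENNReal.toReal_ofNat] at h2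
    linarith
  have hB : 0 ≤ B ^ 2 := sq_nonneg B
  unfold sobQ sobOn
  calc _ ≤ ∑ a ∈ Finset.range (m + 1), 12 * B ^ 2 := by
        refine Finset.sum_le_sum fun a ha => ?_
        have ha' := Finset.mem_range.1 ha
        refine (Finset.sum_le_card_nsmul _ _ _ fun b hb =>
          hI a (by omega) b (by have := Finset.mem_range.1 hb; omega)).trans ?_
        have : ((m + 1 - a : ℕ) : ℝ) ≤ 3 := by exact_mod_cast (by omega : m + 1 - a ≤ 3)
        rw [Finset.card_range, nsmul_eq_mul]
        nlinarith
    _ ≤ _ := by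
        have : (m : ℝ) ≤ 2 := by exact_mod_cast hm
        rw [Finset.sum_const, Finset.card_range, nsmul_eq_mul]
        push_cast
        nlinarith

lemma IsPoly2.sum {ι : Type*} (s : Finset ι) {W : ℕ} {f : ι → ℝ × ℝ → ℝ}
    (h : ∀ i ∈ s, IsPoly2 W (f i)) : IsPoly2 W (fun z => ∑ i ∈ s, f i z) := by
  choose! c hc using h
  refine ⟨fun k l => ∑ i ∈ s, c i k l, fun z => ?_⟩
  simp only [Finset.sum_mul]
  rw [Finset.sum_congr rfl fun i hi => hc i hi z, Finset.sum_comm]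
  exact Finset.sum_congr rfl fun k _ => Finset.sum_comm

lemma isPoly2_const_mul_eval_mul_eval {W : ℕ} {P R : Polynomial ℝ} (hP : P.natDegree ≤ W)
    (hR : R.natDegree ≤ W) (r : ℝ) : IsPoly2 W (fun z => r * (P.eval z.1 * R.eval z.2)) := by
  refine ⟨fun k l => r * (P.coeff k * R.coeff l), fun z => ?_⟩
  change r * (P.eval z.1 * R.eval z.2) = _
  rw [Polynomial.eval_eq_sum_range' (Nat.lt_succ_of_le hP),
    Polynomial.eval_eq_sum_range' (Nat.lt_succ_of_le hR), Finset.sum_mul_sum, Finset.mul_sum]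
  refine Finset.sum_congr rfl fun k _ => ?_
  rw [Finset.mul_sum]
  exact Finset.sum_congr rfl fun l _ => by ring

section decay

variable {v : ℝ × ℝ → ℝ} {C d τ : ℝ} {p : ℕ}

lemma abs_chebCoeff_le_pow_mul_pow (hv : ContDiffOn ℝ (⊤ : ℕ∞) v closedSq) (hC : 0 < C)
    (hd : 0 < d) (h : ∀ s : ℕ, Real.sqrt (sobQ s v) ≤ C * d ^ s * (Nat.factorial s : ℝ))
    (hp : 2 * d + 1 ≤ p) (hτ0 : 0 < τ) (hτ1 : τ < 1)
    (hτ : ∀ i : ℕ, (1 / 2 : ℝ) ^ (i / p) ≤ 2 * (τ ^ 4) ^ i) (i j : ℕ) :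
    |chebCoeff v i j| ≤ 10 * C * (τ ^ (2 * i) * τ ^ (2 * j)) := by
  have hsq (s : ℕ) : sobQ s v ≤ (C * d ^ s * (Nat.factorial s : ℝ)) ^ 2 :=
    (Real.sqrt_le_left (by positivity)).1 (h s)
  have hx (i j : ℕ) : |chebCoeff v i j| ≤ 5 * C * (1 / 2) ^ (i / p) :=
    abs_chebCoeff_le_geometric hv hC hd
      (fun s => (setIntegral_Dab_sq_le_sobQ s 0 v).trans (hsq s)) hp i j
  have hy (i j : ℕ) : |chebCoeff v i j| ≤ 5 * C * (1 / 2) ^ (j / p) := by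
    rw [← chebCoeff_comp_swap]
    refine abs_chebCoeff_le_geometric hv.comp_swap hC hd (fun s => ?_) hp j i
    have := (setIntegral_Dab_sq_le_sobQ 0 s v).trans (hsq (0 + s))
    rw [zero_add] at this
    rw [iterate_pdx_comp_swap]
    exact (setIntegral_Q2_comp_swap fun z => (pdy^[s] v z) ^ 2).trans_le this
  have key {m : ℕ} (hm : i + j ≤ 2 * m) : 5 * C * (1 / 2) ^ (m / p) ≤
      10 * C * (τ ^ (2 * i) * τ ^ (2 * j)) := by
    have h1 : (τ ^ 4) ^ m ≤ τ ^ (2 * i) * τ ^ (2 * j) := by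
      rw [← pow_mul, ← pow_add]
      exact pow_le_pow_of_le_one hτ0.le hτ1.le (by omega)
    nlinarith [hτ m]
  rcases le_total i j with hij | hij
  · exact (hy i j).trans (key (by omega))
  · exact (hx i j).trans (key (by omega))

lemma two_div_pi_sq_le_one : (2 / Real.pi) ^ 2 ≤ 1 := by
  refine pow_le_one₀ (by positivity) ?_
  rw [div_le_one Real.pi_pos]
  exact Real.two_le_pi

/-- Truncating the Chebyshev expansion leaves an exponentially small remainder, uniformly in all
derivatives of order at most two in each variable. -/
lemma exists_isPoly2_abs_Dab_sub_le (hv : ContinuousOn v closedSq) {A : ℝ} (hτ0 : 0 < τ)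
    (hτ1 : τ < 1) (hβ : ∀ i j, |chebCoeff v i j| ≤ A * (τ ^ (2 * i) * τ ^ (2 * j))) (W : ℕ) :
    ∃ Φ : ℝ × ℝ → ℝ, IsPoly2 W Φ ∧ ∀ a b, ∀ z ∈ Q2, |Dab a b (fun z => v z - Φ z) z| ≤
      A * τ ^ W * ((∑' n : ℕ, τ ^ n * (n : ℝ) ^ (2 * a + 1)) *
        ∑' n : ℕ, τ ^ n * (n : ℝ) ^ (2 * b + 1)) := by
  have hA : 0 ≤ A := by simpa using (abs_nonneg _).trans (hβ 0 0)
  let S : Finset (ℕ × ℕ) := Finset.range (W + 1) ×ˢ Finset.range (W + 1)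
  let coef : ℕ × ℕ → ℝ := fun q => (2 / Real.pi) ^ 2 * chebCoeff v q.1 q.2
  let c : ℕ × ℕ → ℝ := fun q => if q ∈ S then 0 else coef q
  have hcoef (q : ℕ × ℕ) : |coef q| ≤ A * (τ ^ (2 * q.1) * τ ^ (2 * q.2)) := by
    rw [abs_mul, abs_of_nonneg (by positivity)]
    exact (mul_le_of_le_one_left (abs_nonneg _) two_div_pi_sq_le_one).trans (hβ _ _)
  have hc (q : ℕ × ℕ) : |c q| ≤ A * τ ^ W * (τ ^ q.1 * τ ^ q.2) := by
    by_cases hq : q ∈ S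
    · simp only [c, if_pos hq, abs_zero]
      positivity
    · simp only [c, if_neg hq]
      refine (hcoef q).trans ?_
      rw [mul_assoc, ← pow_add, ← pow_add, ← pow_add]
      refine mul_le_mul_of_nonneg_left (pow_le_pow_of_le_one hτ0.le hτ1.le ?_) hA
      simp only [S, Finset.mem_product, Finset.mem_range] at hq
      omega
  have hs : Summable fun q : ℕ × ℕ => chebCoeff v q.1 q.2 := by
    have hg : Summable fun n : ℕ => τ ^ (2 * n) := by
      simpa only [pow_mul] using summable_geometric_of_lt_one (by positivity)
        (pow_lt_one₀ hτ0.le hτ1 two_ne_zero)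
    exact Summable.of_norm_bounded ((hg.mul_of_nonneg hg (fun _ => by positivity)
      fun _ => by positivity).mul_left A) fun q => hβ q.1 q.2
  refine ⟨fun z => ∑ q ∈ S, coef q * ((chebU q.1).eval z.1 * (chebU q.2).eval z.2),
    IsPoly2.sum S fun q hq => ?_, fun a b z hz => ?_⟩
  · simp only [S, Finset.mem_product, Finset.mem_range, Nat.lt_succ_iff] at hq
    exact isPoly2_const_mul_eval_mul_eval ((natDegree_chebU_le _).trans hq.1)
      ((natDegree_chebU_le _).trans hq.2) _
  · rw [Dab_eqOn_chebSeries hτ0 hτ1 hc (fun z hz => ?_) a b hz]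
    · exact abs_chebSeries_le hτ0 hτ1 hc a b hz
    · have h1 := hasSum_sum_of_ne_finset_zero (s := S)
        (L := SummationFilter.unconditional _)
        (f := fun q => if q ∈ S then coef q * ((chebU q.1).eval z.1 * (chebU q.2).eval z.2) else 0)
        fun q hq => if_neg hq
      rw [Finset.sum_congr rfl fun q hq => if_pos hq] at h1
      refine ((hasSum_chebU hv hs hz).sub h1).tsum_eq.symm.trans (tsum_congr fun q => ?_)
      by_cases hq : q ∈ S <;> simp [c, coef, hq]

end decay

/-- **Exponential polynomial approximation of analytic functions in the `H²`-norm on the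
reference square** (derived in the proof of Theorem 5.1): if `v` is infinitely
differentiable on `Q̄` and satisfies `‖v‖_{s,Q} ≤ C d^s s!` for all `s`, then there are
`c', b > 0` depending only on `C` and `d` such that for every sufficiently large `W`
there is a polynomial `Φ` of degree `≤ W` in each variable with
`‖v - Φ‖_{2,Q}² ≤ c' e^{-bW}`, and likewise for the `1`- and `0`-norms. -/
theorem analytic_polynomial_approximation (C d : ℝ) (hC : 0 < C) (hd : 0 < d) :
    ∃ c' > (0 : ℝ), ∃ b > (0 : ℝ), ∃ W₀ : ℕ,
      ∀ v : ℝ × ℝ → ℝ, ContDiffOn ℝ (⊤ : ℕ∞) v (closure Q2) →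
        (∀ s : ℕ, Real.sqrt (sobQ s v) ≤ C * d ^ s * (Nat.factorial s : ℝ)) →
        ∀ W : ℕ, W₀ ≤ W →
          ∃ Φ : ℝ × ℝ → ℝ, IsPoly2 W Φ ∧
            sobQ 2 (fun z => v z - Φ z) ≤ c' * Real.exp (-(b * W)) ∧
            sobQ 1 (fun z => v z - Φ z) ≤ c' * Real.exp (-(b * W)) ∧
            sobQ 0 (fun z => v z - Φ z) ≤ c' * Real.exp (-(b * W)) := by
  obtain ⟨p, hp⟩ := exists_nat_ge (2 * d + 1)
  have hp0 : 0 < p := by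
    have : (0 : ℝ) < p := by linarith
    exact_mod_cast this
  obtain ⟨τ, hτ0, hτ1, hτ⟩ := exists_half_pow_div_le hp0
  let t : ℕ → ℝ := fun a => ∑' n : ℕ, τ ^ n * (n : ℝ) ^ (2 * a + 1)
  have ht (a : ℕ) : 0 ≤ t a := tsum_nonneg fun n => by positivity
  have htM {a : ℕ} (ha : a ≤ 2) : t a ≤ ∑ k ∈ Finset.range 3, t k :=
    Finset.single_le_sum (fun k _ => ht k) (Finset.mem_range.2 (by omega))
  set M := ∑ k ∈ Finset.range 3, t k with hM
  have hM0 : 0 ≤ M := (ht 0).trans (htM (by norm_num))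
  refine ⟨36 * (10 * C * (M * M)) ^ 2 + 1, by positivity, -(2 * Real.log τ), by
    linarith [Real.log_neg hτ0 hτ1], 0, fun v hv h W _ => ?_⟩
  rw [closure_Q2] at hv
  obtain ⟨Φ, hΦ, hD⟩ := exists_isPoly2_abs_Dab_sub_le hv.continuousOn hτ0 hτ1
    (abs_chebCoeff_le_pow_mul_pow hv hC hd h hp hτ0 hτ1 hτ) W
  have hexp : Real.exp (-(-(2 * Real.log τ) * W)) = (τ ^ W) ^ 2 := by
    rw [show -(-(2 * Real.log τ) * W) = ((W * 2 : ℕ) : ℝ) * Real.log τ by push_cast; ring,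
      Real.exp_nat_mul, Real.exp_log hτ0, pow_mul]
  have hmain {m : ℕ} (hm : m ≤ 2) : sobQ m (fun z => v z - Φ z) ≤
      (36 * (10 * C * (M * M)) ^ 2 + 1) * Real.exp (-(-(2 * Real.log τ) * W)) := by
    have hB := sobQ_le_of_abs_Dab_le (u := fun z => v z - Φ z)
      (B := 10 * C * τ ^ W * (M * M)) (fun a ha b hb z hz => (hD a b z hz).trans
        (mul_le_mul_of_nonneg_left (mul_le_mul (htM ha) (htM hb) (ht b) hM0) (by positivity))) hm
    rw [hexp]
    nlinarith [sq_nonneg (τ ^ W)]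
  exact ⟨Φ, hΦ, hmain le_rfl, hmain (by norm_num), hmain (by norm_num)⟩

end
end
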